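/- For every n ≥ 4, there is no suffix-free regular language L with quotient complexity κ(L) = n that simultaneously meets the suffix-free upper bounds for star and for reversal; that is, there is no suffix-free regular L with κ(L) = n, κ(L*) = 2^{n−2} + 1, and κ(L^R) = 2^{n−2} + 1. Consequently, for n ≥ 4 there does not exist a most complex suffix-free language. -/

import Mathlib

/-- The left quotient of a language `L` by a word `w`: `w⁻¹L = {x | wx ∈ L}`. -/
def leftQuot {α : Type} (w : List α) (L : Set (List α)) : Set (List α) := {x | w ++ x ∈ L}

/-- The quotient complexity of a language: the number of its distinct left quotients. -/
noncomputable def quotComp {α : Type} (L : Set (List α)) : ℕ :=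
  {K : Set (List α) | ∃ w : List α, K = leftQuot w L}.ncard

/-- A language is suffix-free if `v ∈ L` and `uv ∈ L` imply `u = ε`. -/
def SuffixFree {α : Type} (L : Set (List α)) : Prop :=
  ∀ u v : List α, v ∈ L → u ++ v ∈ L → u = []

/-- The language accepted by a DFA. -/
def acceptsSet {α Q : Type} (M : DFA α Q) : Set (List α) :=
  {w | M.evalFrom M.start w ∈ M.accept}

/-- A language is regular if it is accepted by some DFA with finitely many states. -/
def RegularLang {α : Type} (L : Set (List α)) : Prop :=
  ∃ (Q : Type) (_ : Fintype Q) (M : DFA α Q), acceptsSet M = L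

/-- The language of a state `q` of a DFA. -/
def stateLang {α Q : Type} (M : DFA α Q) (q : Q) : Set (List α) :=
  {w | M.evalFrom q w ∈ M.accept}

/-- A DFA is minimal if every state is reachable and no two distinct states have
the same language. -/
def MinimalDFA {α Q : Type} (M : DFA α Q) : Prop :=
  (∀ q : Q, ∃ w : List α, M.evalFrom M.start w = q) ∧
    ∀ p q : Q, stateLang M p = stateLang M q → p = q

/-- The transition semigroup of a DFA: the transformations induced by nonempty words. -/
def transSemigroup {α Q : Type} (M : DFA α Q) : Set (Q → Q) :=
  {t | ∃ w : List α, w ≠ [] ∧ t = fun q => M.evalFrom q w}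

/-- Product (concatenation) of two languages. -/
def catLang {α : Type} (K L : Set (List α)) : Set (List α) :=
  {w | ∃ u ∈ K, ∃ v ∈ L, w = u ++ v}

/-- Kleene star of a language. -/
def starLang {α : Type} (L : Set (List α)) : Set (List α) :=
  {w | ∃ ws : List (List α), (∀ u ∈ ws, u ∈ L) ∧ w = ws.flatten}

/-- Reversal of a language. -/
def revLang {α : Type} (L : Set (List α)) : Set (List α) := {w | w.reverse ∈ L}

theorem count_aux {β γ : Type} (T : Set β) (M : Set γ) (hM : M.Finite) (a : β)
    (G : Set γ → β) (h : T ⊆ insert a (G '' (𝒫 M \ {M}))) : T.ncard ≤ 2 ^ M.ncard := by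
  have hP : (𝒫 M).Finite := hM.finite_subsets
  have hD : (𝒫 M \ {M}).Finite := hP.subset Set.sdiff_subset
  have h1 := Set.ncard_le_ncard h ((hD.image G).insert a)
  have h2 := Set.ncard_insert_le a (G '' (𝒫 M \ {M}))
  have h3 := Set.ncard_image_le (f := G) hD
  have h4 : (𝒫 M \ {M}).ncard + 1 = (𝒫 M).ncard :=
    Set.ncard_sdiff_singleton_add_one (by simp) hP
  have h5 : (𝒫 M).ncard = 2 ^ M.ncard := Set.ncard_powerset M hM
  omega

theorem star_append {α : Type} {L : Set (List α)} {u v : List α}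
    (hu : u ∈ starLang L) (hv : v ∈ starLang L) : u ++ v ∈ starLang L := by
  obtain ⟨us, h1, rfl⟩ := hu
  obtain ⟨vs, h2, rfl⟩ := hv
  refine ⟨us ++ vs, ?_, by simp⟩
  intro z hz
  rcases List.mem_append.1 hz with h | h
  · exact h1 z h
  · exact h2 z h

theorem star_of_mem {α : Type} {L : Set (List α)} {u : List α}
    (hu : u ∈ L) : u ∈ starLang L := ⟨[u], by simpa using hu, by simp⟩

theorem star_nil {α : Type} {L : Set (List α)} : [] ∈ starLang L := ⟨[], by simp, by simp⟩

/-- splitting a word of the star at a cut point -/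
theorem star_split {α : Type} {L : Set (List α)} : ∀ (ws : List (List α)),
    (∀ u ∈ ws, u ∈ L) → ∀ w x : List α, w ≠ [] → w ++ x = ws.flatten →
    ∃ u v x1 x2, w = u ++ v ∧ x = x1 ++ x2 ∧ v ≠ [] ∧ u ∈ starLang L ∧ v ++ x1 ∈ L ∧
      x2 ∈ starLang L := by
  intro ws
  induction ws with
  | nil =>
    intro _ w x hw h
    simp at h
    exact absurd h.1 hw
  | cons y ys ih =>
    intro hL w x hw h
    have hy : y ∈ L := hL y (by simp)
    have hys : ∀ u ∈ ys, u ∈ L := fun u hu => hL u (by simp [hu])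
    rw [List.flatten_cons, List.append_eq_append_iff] at h
    rcases h with ⟨a, h1, h2⟩ | ⟨c, h1, h2⟩
    · exact ⟨[], w, a, ys.flatten, by simp, h2, hw, star_nil, h1 ▸ hy, ⟨ys, hys, rfl⟩⟩
    · by_cases hc : c = []
      · subst hc
        refine ⟨[], w, [], x, by simp, by simp, hw, star_nil, ?_, ⟨ys, hys, ?_⟩⟩
        · simpa [h1] using hy
        · simpa using h2.symm
      · obtain ⟨u, v, x1, x2, e1, e2, e3, e4, e5, e6⟩ := ih hys c x hc h2.symm
        exact ⟨y ++ u, v, x1, x2, by simp [h1, e1], e2, e3,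
          star_append (star_of_mem hy) e4, e5, e6⟩

/-- For `n ≥ 4`, there is no suffix-free regular language `L` with quotient
complexity `n` that simultaneously meets the suffix-free bounds for star and
reversal, i.e. with `κ(L*) = 2^{n−2} + 1` and `κ(L^R) = 2^{n−2} + 1`. Consequently,
no most complex suffix-free language exists for `n ≥ 4`. -/
theorem stmt19 (n : ℕ) (hn : 4 ≤ n) :
    ¬ ∃ (α : Type) (L : Set (List α)), RegularLang L ∧ SuffixFree L ∧
        quotComp L = n ∧ quotComp (starLang L) = 2 ^ (n - 2) + 1 ∧
        quotComp (revLang L) = 2 ^ (n - 2) + 1 := by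
  rintro ⟨α, L, -, hsf, hQ, hstar, hrev⟩
  unfold quotComp at hQ hstar hrev
  set Q : Set (Set (List α)) := {K | ∃ w : List α, K = leftQuot w L} with hQdef
  have hQfin : Q.Finite := Set.finite_of_ncard_pos (by omega)
  have hLQ : L ∈ Q := ⟨[], by simp [leftQuot]⟩
  -- a nonempty word with a nontrivial quotient
  have hne : ∃ K ∈ Q, K ≠ L := by
    by_contra! hcon
    have : Q ⊆ {L} := fun K hK => hcon K hK
    have := Set.ncard_le_ncard this
    simp at this
    omega
  obtain ⟨a⟩ : Nonempty α := by
    obtain ⟨K, ⟨w, rfl⟩, hK⟩ := hne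
    cases w with
    | nil => exact absurd (by simp [leftQuot]) hK
    | cons a _ => exact ⟨a⟩
  have hLne : L.Nonempty := by
    rw [Set.nonempty_iff_ne_empty]
    rintro rfl
    obtain ⟨K, ⟨w, rfl⟩, hK⟩ := hne
    exact hK (by simp [leftQuot])
  have hEQ : (∅ : Set (List α)) ∈ Q := by
    have hni : ¬ Function.Injective
        (fun i : ℕ => (⟨leftQuot (List.replicate i a) L, _, rfl⟩ : Q)) := by
      intro hinj
      have := hQfin.to_subtype
      exact not_injective_infinite_finite _ hinj
    have key : ∀ i j : ℕ, i < j →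
        leftQuot (List.replicate i a) L = leftQuot (List.replicate j a) L →
        leftQuot (List.replicate i a) L = ∅ := by
      intro i j hij he
      rw [← Set.not_nonempty_iff_eq_empty]
      rintro ⟨y, hy⟩
      have hy2 : y ∈ leftQuot (List.replicate j a) L := he ▸ hy
      have : List.replicate (j - i) a = [] := by
        apply hsf _ _ hy
        rw [← List.append_assoc, List.replicate_append_replicate]
        have : j - i + i = j := by omega
        rw [this]; exact hy2
      have := congrArg List.length this
      simp at this
      omega
    simp only [Function.Injective, not_forall] at hni
    obtain ⟨i, j, he, hij⟩ := hni
    have he : leftQuot (List.replicate i a) L = leftQuot (List.replicate j a) L :=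
      congrArg Subtype.val he
    rcases lt_or_gt_of_ne hij with h | h
    · exact ⟨_, (key i j h he).symm⟩
    · exact ⟨_, (key j i h he.symm).symm⟩
  -- quotients by nonempty words differ from `L`
  have hqL : ∀ w, leftQuot w L = L → w = [] := by
    intro w hw
    obtain ⟨v, hv⟩ := hLne
    exact hsf w v hv (by have : v ∈ leftQuot w L := by rw [hw]; exact hv
                         exact this)
  set M : Set (Set (List α)) := (Q \ {L}) \ {∅} with hMdef
  have hMfin : M.Finite := hQfin.subset (fun K hK => hK.1.1)
  have hMcard : M.ncard = n - 2 := by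
    have h1 := Set.ncard_sdiff_singleton_add_one hLQ hQfin
    have h2 := Set.ncard_sdiff_singleton_add_one (s := Q \ {L}) (a := ∅)
      ⟨hEQ, by simpa using hLne.ne_empty.symm⟩ (hQfin.subset Set.sdiff_subset)
    have h3 : M.ncard + 1 = (Q \ {L}).ncard := h2
    have h4 : Q.ncard = n := hQ
    omega
  -- star
  obtain ⟨w, hw⟩ : ∃ w, M ⊆ {K | ∃ u v, w = u ++ v ∧ K = leftQuot v L} := by
    by_contra! hcon
    have := count_aux {K | ∃ w, K = leftQuot w (starLang L)} M hMfin (starLang L)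
      (fun A => {x | ∃ K ∈ A, ∃ x1 ∈ K, ∃ x2 ∈ starLang L, x = x1 ++ x2}) ?_
    · rw [hMcard] at this; omega
    rintro _ ⟨w, rfl⟩
    by_cases hw : w = []
    · left; simp [leftQuot, hw]
    right
    refine ⟨{K | K ∈ M ∧ ∃ u v, w = u ++ v ∧ u ∈ starLang L ∧ K = leftQuot v L},
      ⟨fun K hK => hK.1, ?_⟩, ?_⟩
    · intro he
      apply hcon w
      intro K hK
      rw [← Set.mem_singleton_iff.1 he] at hK
      obtain ⟨-, u, v, h1, -, h2⟩ := hK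
      exact ⟨u, v, h1, h2⟩
    · ext x
      constructor
      · rintro ⟨K, ⟨-, u, v, rfl, hu, rfl⟩, x1, hx1, x2, hx2, rfl⟩
        have := star_append hu (star_append (star_of_mem hx1) hx2)
        simpa [leftQuot] using this
      · rintro ⟨ws, hws, he⟩
        obtain ⟨u, v, x1, x2, e1, e2, e3, e4, e5, e6⟩ := star_split ws hws w x hw he
        refine ⟨leftQuot v L, ⟨⟨⟨⟨v, rfl⟩, fun h => e3 (hqL v h)⟩, fun h => ?_⟩,
          u, v, e1, e4, rfl⟩, x1, e5, x2, e6, e2⟩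
        have h5 : x1 ∈ leftQuot v L := e5
        rw [Set.mem_singleton_iff.1 h] at h5
        exact h5
  -- reversal
  obtain ⟨y, hy⟩ : ∃ y, ∀ K ∈ M, y ∈ K := by
    by_contra! hcon
    have := count_aux {K | ∃ w, K = leftQuot w (revLang L)} M hMfin
      {x | leftQuot x.reverse L = L}
      (fun A => {x | leftQuot x.reverse L ∈ A}) ?_
    · rw [hMcard] at this; omega
    rintro _ ⟨w, rfl⟩
    by_cases hw : w.reverse ∈ L
    · left
      ext x
      simp only [leftQuot, revLang, Set.mem_ofPred_eq, List.reverse_append]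
      constructor
      · intro h
        have := hsf _ _ hw h
        simp [this]
      · intro h
        have := hqL _ h
        simpa [this] using hw
    · right
      refine ⟨{K | K ∈ M ∧ w.reverse ∈ K}, ⟨fun K hK => hK.1, ?_⟩, ?_⟩
      · intro he
        obtain ⟨K, hK, hK2⟩ := hcon w.reverse
        rw [← Set.mem_singleton_iff.1 he] at hK
        exact hK2 hK.2
      · ext x
        constructor
        · rintro ⟨-, h⟩
          simpa [leftQuot, revLang] using h
        · intro h
          have h' : w.reverse ∈ leftQuot x.reverse L := by
            simpa [leftQuot, revLang] using h
          refine ⟨⟨⟨⟨_, rfl⟩, fun h2 => ?_⟩, fun h2 => ?_⟩, h'⟩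
          · rw [Set.mem_singleton_iff.1 h2] at h'; exact hw h'
          · rw [Set.mem_singleton_iff.1 h2] at h'; exact h'
  -- contradiction
  obtain ⟨K1, hK1, K2, hK2, hne12⟩ := (Set.one_lt_ncard hMfin).1 (by omega : 1 < M.ncard)
  have main : ∀ v1 v2 : List α, v1 <:+ v2 → leftQuot v1 L ∈ M → leftQuot v2 L ∈ M →
      v1 = v2 := by
    rintro v1 _ ⟨z, rfl⟩ h1 h2
    have m1 : v1 ++ y ∈ L := hy _ h1
    have m2 : z ++ v1 ++ y ∈ L := hy _ h2
    have := hsf z _ m1 (by simpa using m2)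
    simp [this]
  obtain ⟨u1, v1, e1, rfl⟩ := hw hK1
  obtain ⟨u2, v2, e2, rfl⟩ := hw hK2
  rcases List.suffix_or_suffix_of_suffix ⟨u1, e1.symm⟩ ⟨u2, e2.symm⟩ with h | h
  · exact hne12 (by rw [main _ _ h hK1 hK2])
  · exact hne12 (by rw [main _ _ h hK2 hK1])
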